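/- Let A ≥ 2, n, r, e, f be non-negative integers with e + f ≤ A(n+1) − 2, with e odd, f even, and r ≥ n + 1. Then the series Σ_{k_1 ≥ k_2 ≥ 1} (k_1 + k_2 + n + r)^e (k_1 − k_2 + r)^f / ((k_1+r)_{n+1}^A (k_2)_{n+1}^A) is a ℚ-linear combination of: 1; the values ζ(s) with 2 ≤ s ≤ A; the values ζ(s) with A + 1 ≤ s ≤ 2A − 1 and s odd; and the products ζ(s)ζ(s') with 2 ≤ s < s' ≤ A and s' ≢ s (mod 2). -/

import Mathlib

/-- The value `ζ(s) = ∑_{k ≥ 1} 1/k^s` of the Riemann zeta function. -/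
noncomputable def zv (s : ℕ) : ℝ := ∑' k : ℕ+, ((k : ℝ) ^ s)⁻¹

open Polynomial Filter

theorem aeval_ascPochhammer_rat (m : ℕ) (x : ℝ) :
    aeval x (ascPochhammer ℚ m) = (ascPochhammer ℝ m).eval x := by
  rw [aeval_def, eval₂_eq_eval_map, ascPochhammer_map]

theorem ascPochhammer_eval_one_sub_sub (m : ℕ) (x : ℝ) :
    (ascPochhammer ℝ m).eval (1 - m - x) = (-1) ^ m * (ascPochhammer ℝ m).eval x := by
  have h := ascPochhammer_eval_neg_eq_descPochhammer ℝ (x + (m : ℝ) - 1) m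
  rw [descPochhammer_eval_eq_ascPochhammer] at h
  rw [show (1 - (m : ℝ) - x) = -(x + (m : ℝ) - 1) by ring, h]
  congr 2
  ring

theorem ascPochhammer_eval_eq_prod (m : ℕ) (x : ℝ) :
    (ascPochhammer ℝ m).eval x = ∏ p ∈ Finset.range m, (x + p) := by
  induction m with
  | zero => simp
  | succ m ih => rw [ascPochhammer_succ_eval, Finset.prod_range_succ, ih]

/-- Partial fraction decomposition of `N / (X)_{c+1} ^ M`. -/
theorem exists_partialFractions (N : ℚ[X]) (c M : ℕ) (hdeg : N.natDegree + 2 ≤ M * (c + 1)) :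
    ∃ q : ℕ → ℕ → ℚ, ∀ x : ℝ, (∀ p ∈ Finset.range (c + 1), x + p ≠ 0) →
      aeval x N / (ascPochhammer ℝ (c + 1)).eval x ^ M =
        ∑ p ∈ Finset.range (c + 1), ∑ s ∈ Finset.range M,
          (q p s : ℝ) * ((x + p) ^ (s + 1))⁻¹ := by
  obtain ⟨Q, r, hr, hN⟩ := eq_quo_mul_prod_pow_add_sum_rem_mul_prod_pow
    (s := Finset.range (c + 1)) N (g := fun p : ℕ => X + C (p : ℚ))
    (fun i _ => monic_X_add_C _)
    (by
      intro i _ j _ hij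
      have := isCoprime_X_sub_C_of_isUnit_sub (a := -(i : ℚ)) (b := -(j : ℚ))
        (IsUnit.mk0 _ (by rw [sub_ne_zero]; simpa using hij))
      simpa using this) (fun _ => M)
  have hev : ∀ x : ℝ, (∀ p ∈ Finset.range (c + 1), x + p ≠ 0) →
      aeval x N / (ascPochhammer ℝ (c + 1)).eval x ^ M = aeval x Q +
        ∑ p ∈ Finset.range (c + 1), ∑ s ∈ Finset.range M,
          ((if h : s < M then (r p (Fin.rev ⟨s, h⟩)).coeff 0 else 0 : ℚ) : ℝ) *
            ((x + p) ^ (s + 1))⁻¹ := by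
    intro x hx
    have hP : ∏ p ∈ Finset.range (c + 1), (x + (p : ℝ)) ^ M ≠ 0 :=
      Finset.prod_ne_zero_iff.2 fun p hp => pow_ne_zero _ (hx p hp)
    rw [ascPochhammer_eval_eq_prod, ← Finset.prod_pow, div_eq_iff hP, add_mul, Finset.sum_mul]
    conv_lhs => rw [hN]
    simp only [map_add, map_mul, map_sum, map_prod, map_pow, aeval_X, aeval_C]
    congr 1
    refine Finset.sum_congr rfl fun p hp => ?_
    rw [Finset.sum_mul, Finset.sum_range, ← Equiv.sum_comp Fin.revPerm]
    refine Finset.sum_congr rfl fun i _ => ?_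
    rw [← Finset.mul_prod_erase _ _ hp, dif_pos i.2, Fin.revPerm_apply,
      eq_C_of_degree_le_zero (p := r p i.rev) ?_]
    · have h0 := hx p hp
      have : (x + (p : ℝ)) ^ M = (x + p) ^ (i.rev : ℕ) * (x + p) ^ ((i : ℕ) + 1) := by
        rw [← pow_add, Fin.val_rev]
        congr 1
        omega
      rw [this]
      simp only [aeval_C, coeff_C_zero, eq_ratCast, Rat.cast_natCast]
      field_simp
    · have := hr p hp i.rev
      rw [degree_X_add_C] at this
      exact Nat.WithBot.lt_one_iff_le_zero.1 this
  have hQ : Q = 0 := by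
    have h1 : Tendsto (fun x : ℝ => aeval x N / (ascPochhammer ℝ (c + 1)).eval x ^ M) atTop
        (nhds 0) := by
      have := div_tendsto_atTop_zero_of_degree_lt (N.map (algebraMap ℚ ℝ))
        (ascPochhammer ℝ (c + 1) ^ M) (by
          have hm := (monic_ascPochhammer ℝ (c + 1)).pow M
          rw [degree_eq_natDegree hm.ne_zero, natDegree_pow, ascPochhammer_natDegree]
          refine lt_of_le_of_lt degree_le_natDegree ?_
          rw [natDegree_map]
          exact_mod_cast (by omega))
      simpa using this
    have h2 : Tendsto (fun x : ℝ => ∑ p ∈ Finset.range (c + 1), ∑ s ∈ Finset.range M,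
          ((if h : s < M then (r p (Fin.rev ⟨s, h⟩)).coeff 0 else 0 : ℚ) : ℝ) *
            ((x + p) ^ (s + 1))⁻¹) atTop (nhds 0) := by
      have h5 : ∀ p ∈ Finset.range (c + 1), ∀ s ∈ Finset.range M, Tendsto (fun x : ℝ =>
          ((if h : s < M then (r p (Fin.rev ⟨s, h⟩)).coeff 0 else 0 : ℚ) : ℝ) *
            ((x + p) ^ (s + 1))⁻¹) atTop (nhds 0) := by
        intro p _ s _
        rw [← mul_zero (((if h : s < M then (r p (Fin.rev ⟨s, h⟩)).coeff 0 else 0 : ℚ) : ℝ))]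
        refine Tendsto.const_mul _ (tendsto_inv_atTop_zero.comp ?_)
        exact (tendsto_pow_atTop (by omega)).comp (tendsto_atTop_add_const_right _ _ tendsto_id)
      simpa using tendsto_finsetSum _ fun p hp => tendsto_finsetSum _ (h5 p hp)
    have h3 : Tendsto (fun x : ℝ => (Q.map (algebraMap ℚ ℝ)).eval x) atTop (nhds 0) := by
      have := h1.sub h2
      rw [sub_zero] at this
      refine this.congr' ?_
      filter_upwards [eventually_gt_atTop 0] with x hx
      rw [hev x fun p _ => by positivity]
      simp
    have h4 := ((tendsto_nhds_iff _).1 h3).1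
    rwa [leadingCoeff_eq_zero, Polynomial.map_eq_zero] at h4
  refine ⟨fun p s => if h : s < M then (r p (Fin.rev ⟨s, h⟩)).coeff 0 else 0, fun x hx => ?_⟩
  rw [hev x hx, hQ, map_zero, zero_add]

theorem summable_aeval_div (N : ℚ[X]) (c M : ℕ) (hdeg : N.natDegree + 2 ≤ M * (c + 1)) :
    Summable fun b : ℕ => aeval ((b : ℝ) + 1) N /
      (ascPochhammer ℝ (c + 1)).eval ((b : ℝ) + 1) ^ M := by
  have h1 : (fun x : ℝ => (N.map (algebraMap ℚ ℝ) * X ^ 2).eval x) =O[atTop]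
      fun x => (ascPochhammer ℝ (c + 1) ^ M).eval x := by
    refine isBigO_atTop_of_degree_le _ _ ?_
    have hm := (monic_ascPochhammer ℝ (c + 1)).pow M
    rw [degree_eq_natDegree hm.ne_zero, natDegree_pow, ascPochhammer_natDegree]
    refine degree_le_natDegree.trans ?_
    have := natDegree_mul_le (p := N.map (algebraMap ℚ ℝ)) (q := X ^ 2)
    rw [natDegree_map, natDegree_X_pow] at this
    exact_mod_cast this.trans hdeg
  have h2 : (fun x : ℝ => aeval x N / (ascPochhammer ℝ (c + 1)).eval x ^ M) =O[atTop]
      fun x => (x ^ 2)⁻¹ := by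
    obtain ⟨C, hC⟩ := h1.bound
    refine Asymptotics.IsBigO.of_bound C ?_
    filter_upwards [hC, eventually_gt_atTop 0] with x hx h0
    have hp := pow_pos (ascPochhammer_pos (c + 1) x h0) M
    simp only [eval_mul, eval_pow, eval_X, eval_map_algebraMap, norm_mul, norm_div, norm_inv]
      at hx ⊢
    have h0' : 0 < ‖x ^ 2‖ := by rw [norm_pos_iff]; positivity
    rw [div_le_iff₀ (norm_pos_iff.2 hp.ne'), mul_right_comm, ← div_eq_mul_inv, le_div_iff₀ h0']
    exact hx
  have h3 : Summable fun b : ℕ => ((((b : ℝ) + 1)) ^ 2)⁻¹ := by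
    have := (summable_nat_add_iff 1).2 (Real.summable_nat_pow_inv.2 one_lt_two)
    simpa using this
  refine summable_of_isBigO_nat h3 (h2.comp_tendsto (k := fun b : ℕ => (b : ℝ) + 1) ?_)
  exact tendsto_atTop_add_const_right _ _ tendsto_natCast_atTop_atTop

theorem hasSum_congr {ι : Type*} {f g : ι → ℝ} {a : ℝ} (h : ∀ i, f i = g i) :
    HasSum f a ↔ HasSum g a := by
  rw [funext h]

theorem hasSum_sub_succ_of_antitone {f : ℕ → ℝ} (hf : Antitone f)
    (h0 : Tendsto f atTop (nhds 0)) : HasSum (fun b => f b - f (b + 1)) (f 0) := by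
  rw [hasSum_iff_tendsto_nat_of_nonneg fun b => sub_nonneg.2 (hf b.le_succ)]
  simp only [Finset.sum_range_sub']
  simpa using h0.const_sub (f 0)

theorem hasSum_inv_pow_shift_sub (s p : ℕ) :
    HasSum (fun b : ℕ => (((b : ℝ) + 1 + p) ^ (s + 1))⁻¹ - (((b : ℝ) + 1) ^ (s + 1))⁻¹)
      (-∑ i ∈ Finset.range p, (((i : ℝ) + 1) ^ (s + 1))⁻¹) := by
  induction p with
  | zero => simp
  | succ p ih =>
    have h := hasSum_sub_succ_of_antitone (f := fun b : ℕ => (((b : ℝ) + 1 + p) ^ (s + 1))⁻¹)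
      (by
        intro a b hab
        dsimp only
        gcongr)
      (by
        refine tendsto_inv_atTop_zero.comp ((tendsto_pow_atTop (by omega)).comp ?_)
        refine tendsto_atTop_add_const_right _ _ (tendsto_atTop_add_const_right _ _ ?_)
        exact tendsto_natCast_atTop_atTop)
    rw [Finset.sum_range_succ, neg_add, ← sub_eq_add_neg, show (p : ℝ) + 1 = (0 : ℕ) + 1 + p by
      rw [Nat.cast_zero]; ring]
    refine (hasSum_congr fun b => ?_).1 (ih.sub h)
    rw [show (b : ℝ) + 1 + (p + 1 : ℕ) = (b + 1 : ℕ) + 1 + p by push_cast; ring]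
    ring

theorem hasSum_zv (s : ℕ) (hs : 2 ≤ s) : HasSum (fun b : ℕ => (((b : ℝ) + 1) ^ s)⁻¹) (zv s) := by
  have h : Summable fun b : ℕ => (((b : ℝ) + 1) ^ s)⁻¹ := by
    have := (summable_nat_add_iff 1).2 (Real.summable_nat_pow_inv.2 (by omega : 1 < s))
    simpa using this
  have h2 : zv s = ∑' b : ℕ, (((b : ℝ) + 1) ^ s)⁻¹ := by
    rw [zv, tsum_pnat_eq_tsum_succ (f := fun n : ℕ => ((n : ℝ) ^ s)⁻¹)]
    simp
  rw [h2]
  exact h.hasSum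

/-- The rational span of `1` and of the `ζ(s)` with `2 ≤ s ≤ M` and `s ≡ ε` modulo `2`. -/
noncomputable def zetaSpan (M ε : ℕ) : Submodule ℚ ℝ :=
  Submodule.span ℚ (insert 1 (zv '' {s | 2 ≤ s ∧ s ≤ M ∧ s % 2 = ε % 2}))

/-- A symmetric rational function with poles among `0, -1, …, -c` is, up to a function with rational
sum, a rational linear combination of the `1 / x ^ s` with `s ≡ ε` modulo `2`. -/
theorem exists_hasSum_sub_sum (N : ℚ[X]) (c M ε : ℕ) (hdeg : N.natDegree + 2 ≤ M * (c + 1))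
    (hsym : ∀ x : ℝ, aeval (-c - x) N = (-1) ^ (ε + M * (c + 1)) * aeval x N) :
    ∃ (K : ℕ → ℚ) (t : ℚ), (∀ s, (s + 1) % 2 ≠ ε % 2 → K s = 0) ∧
      HasSum (fun b : ℕ => aeval ((b : ℝ) + 1) N /
        (ascPochhammer ℝ (c + 1)).eval ((b : ℝ) + 1) ^ M -
          ∑ s ∈ Finset.range M, (K s : ℝ) * (((b : ℝ) + 1) ^ (s + 1))⁻¹) (t : ℝ) := by
  obtain ⟨q, hq⟩ := exists_partialFractions N c M hdeg
  set g : ℕ → ℕ → ℚ := fun s p => -∑ i ∈ Finset.range p, (((i : ℚ) + 1) ^ (s + 1))⁻¹ with hg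
  have hshift : ∀ s p : ℕ, HasSum (fun b : ℕ => (((b : ℝ) + 1 + p) ^ (s + 1))⁻¹ -
      (((b : ℝ) + 1) ^ (s + 1))⁻¹) ((g s p : ℚ) : ℝ) := by
    intro s p
    have := hasSum_inv_pow_shift_sub s p
    simpa [hg] using this
  refine ⟨fun s => ∑ p ∈ Finset.range (c + 1), q p s * ((1 + (-1) ^ (ε + (s + 1))) / 2),
    ∑ p ∈ Finset.range (c + 1), ∑ s ∈ Finset.range M,
      q p s / 2 * (g s p + (-1) ^ (ε + (s + 1)) * g s (c - p)), ?_, ?_⟩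
  · intro s hs
    have : Odd (ε + (s + 1)) := by rw [Nat.odd_iff]; omega
    simp [this.neg_one_pow]
  have key : HasSum (fun b : ℕ => ∑ p ∈ Finset.range (c + 1), ∑ s ∈ Finset.range M,
      (q p s / 2 : ℝ) * (((((b : ℝ) + 1 + p) ^ (s + 1))⁻¹ - (((b : ℝ) + 1) ^ (s + 1))⁻¹) +
        (-1) ^ (ε + (s + 1)) * ((((b : ℝ) + 1 + (c - p : ℕ)) ^ (s + 1))⁻¹ -
          (((b : ℝ) + 1) ^ (s + 1))⁻¹)))
      (∑ p ∈ Finset.range (c + 1), ∑ s ∈ Finset.range M,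
        (q p s / 2 : ℝ) * ((g s p : ℚ) + (-1) ^ (ε + (s + 1)) * (g s (c - p) : ℚ))) :=
    hasSum_sum fun p _ => hasSum_sum fun s _ =>
      ((hshift s p).add ((hshift s (c - p)).mul_left _)).mul_left _
  push_cast
  convert key using 1
  funext b
  have h1 := hq ((b : ℝ) + 1) fun p _ => by positivity
  have h2 := hq (-c - ((b : ℝ) + 1)) fun p hp => by
    have : (p : ℝ) ≤ c := by exact_mod_cast Nat.lt_succ_iff.1 (Finset.mem_range.1 hp)
    have : (0 : ℝ) ≤ b := by positivity
    exact ne_of_lt (by linarith)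
  have h3 := ascPochhammer_eval_one_sub_sub (c + 1) ((b : ℝ) + 1)
  rw [show (1 : ℝ) - (c + 1 : ℕ) - (b + 1) = -c - (b + 1) by push_cast; ring] at h3
  rw [hsym, h3, mul_pow, ← pow_mul, pow_add, mul_comm (c + 1) M, mul_right_comm,
    mul_comm _ ((-1 : ℝ) ^ (M * (c + 1))), mul_div_mul_left _ _ (by simp), mul_div_assoc] at h2
  set R := aeval ((b : ℝ) + 1) N / (ascPochhammer ℝ (c + 1)).eval ((b : ℝ) + 1) ^ M with hR
  have hεε : ((-1 : ℝ) ^ ε) * (-1) ^ ε = 1 := by rw [← pow_add, Even.neg_one_pow ⟨ε, rfl⟩]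
  have h4 : R = ∑ p ∈ Finset.range (c + 1), ∑ s ∈ Finset.range M,
      (q p s : ℝ) * ((-1) ^ (ε + (s + 1)) * (((b : ℝ) + 1 + (c - p : ℕ)) ^ (s + 1))⁻¹) := by
    calc R = (-1) ^ ε * ((-1) ^ ε * R) := by rw [← mul_assoc, hεε, one_mul]
      _ = _ := by
        rw [h2, Finset.mul_sum]
        refine Finset.sum_congr rfl fun p hp => ?_
        rw [Finset.mul_sum]
        refine Finset.sum_congr rfl fun s _ => ?_
        rw [Nat.cast_sub (Nat.lt_succ_iff.1 (Finset.mem_range.1 hp)),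
          show (-c - ((b : ℝ) + 1) + p) = (-1) * (b + 1 + (c - p)) by ring, mul_pow, mul_inv,
          ← inv_pow, show ((-1 : ℝ)⁻¹) = -1 by norm_num, pow_add]
        ring
  have h5 : R = (R + R) / 2 := by ring
  rw [h5]
  nth_rewrite 1 [h1]
  rw [h4]
  simp only [Finset.sum_mul]
  rw [Finset.sum_comm (s := Finset.range M), ← Finset.sum_add_distrib, Finset.sum_div,
    ← Finset.sum_sub_distrib]
  refine Finset.sum_congr rfl fun p _ => ?_
  rw [← Finset.sum_add_distrib, Finset.sum_div, ← Finset.sum_sub_distrib]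
  refine Finset.sum_congr rfl fun s _ => ?_
  ring

theorem tsum_mem_zetaSpan (N : ℚ[X]) (c M ε : ℕ) (hdeg : N.natDegree + 2 ≤ M * (c + 1))
    (hsym : ∀ x : ℝ, aeval (-c - x) N = (-1) ^ (ε + M * (c + 1)) * aeval x N) :
    ∑' b : ℕ, aeval ((b : ℝ) + 1) N / (ascPochhammer ℝ (c + 1)).eval ((b : ℝ) + 1) ^ M ∈
      zetaSpan M ε := by
  obtain ⟨K, t, hK, ht⟩ := exists_hasSum_sub_sum N c M ε hdeg hsym
  obtain ⟨M, rfl⟩ : ∃ m, M = m + 1 := ⟨M - 1, by rcases M with _ | M <;> simp at hdeg ⊢⟩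
  have hz : HasSum (fun b : ℕ => ∑ s ∈ Finset.range M,
      (K (s + 1) : ℝ) * (((b : ℝ) + 1) ^ (s + 1 + 1))⁻¹)
      (∑ s ∈ Finset.range M, (K (s + 1) : ℝ) * zv (s + 1 + 1)) :=
    hasSum_sum fun s _ => (hasSum_zv _ (by omega)).mul_left _
  have hS := summable_aeval_div N c (M + 1) hdeg
  have hK0 : K 0 = 0 := by
    by_contra h0
    have h1 : Summable fun b : ℕ => (K 0 : ℝ) * ((b : ℝ) + 1)⁻¹ := by
      refine ((hS.sub ht.summable).sub hz.summable).congr fun b => ?_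
      rw [Finset.sum_range_succ']
      simp
    rw [summable_mul_left_iff (by exact_mod_cast h0)] at h1
    refine Real.not_summable_natCast_inv ((summable_nat_add_iff 1).1 ?_)
    simpa using h1
  have hsum := ht.add hz
  have hR : HasSum (fun b : ℕ => aeval ((b : ℝ) + 1) N /
      (ascPochhammer ℝ (c + 1)).eval ((b : ℝ) + 1) ^ (M + 1))
      (t + ∑ s ∈ Finset.range M, (K (s + 1) : ℝ) * zv (s + 1 + 1)) := by
    refine (hasSum_congr fun b => ?_).1 hsum
    rw [Finset.sum_range_succ', hK0, Rat.cast_zero, zero_mul, add_zero, sub_add_cancel]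
  rw [hR.tsum_eq]
  refine add_mem ?_ (sum_mem fun s hs => ?_)
  · rw [← mul_one (t : ℝ), ← Rat.smul_def]
    exact Submodule.smul_mem _ _ (Submodule.subset_span (Set.mem_insert _ _))
  · rw [← Rat.smul_def]
    by_cases h : (s + 1 + 1) % 2 = ε % 2
    · exact Submodule.smul_mem _ _ (Submodule.subset_span (Set.mem_insert_of_mem _
        ⟨s + 1 + 1, ⟨by omega, by have := Finset.mem_range.1 hs; omega, h⟩, rfl⟩))
    · rw [hK _ h, zero_smul]
      exact zero_mem _

/-- The space of values allowed in `statement14`. -/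
noncomputable def valueSpan (A : ℕ) : Submodule ℚ ℝ :=
  Submodule.span ℚ {1} ⊔ Submodule.span ℚ (zv '' (Finset.Icc 2 A : Finset ℕ)) ⊔
    Submodule.span ℚ (zv '' ((Finset.Icc (A + 1) (2 * A - 1)).filter (fun s => s % 2 = 1) :
      Finset ℕ)) ⊔
    Submodule.span ℚ ((fun q : ℕ × ℕ => zv q.1 * zv q.2) ''
      ((Finset.Icc 2 A ×ˢ Finset.Icc 2 A).filter
        (fun q => q.1 < q.2 ∧ (q.1 + q.2) % 2 = 1) : Finset (ℕ × ℕ)))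

section valueSpan

variable {A : ℕ}

theorem one_mem_valueSpan : (1 : ℝ) ∈ valueSpan A :=
  Submodule.mem_sup_left (Submodule.mem_sup_left (Submodule.mem_sup_left
    (Submodule.subset_span rfl)))

theorem zv_mem_valueSpan {s : ℕ} (hs : 2 ≤ s) (hsA : s ≤ A) : zv s ∈ valueSpan A :=
  Submodule.mem_sup_left (Submodule.mem_sup_left (Submodule.mem_sup_right
    (Submodule.subset_span ⟨s, by simp [hs, hsA], rfl⟩)))

theorem zv_mem_valueSpan_of_odd {s : ℕ} (hs : A + 1 ≤ s) (hsA : s ≤ 2 * A) (h : s % 2 = 1) :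
    zv s ∈ valueSpan A :=
  Submodule.mem_sup_left (Submodule.mem_sup_right
    (Submodule.subset_span ⟨s, by simp [h]; omega, rfl⟩))

theorem zv_mul_zv_mem_valueSpan {s t : ℕ} (hs : 2 ≤ s) (hsA : s ≤ A) (ht : 2 ≤ t) (htA : t ≤ A)
    (h : (s + t) % 2 = 1) : zv s * zv t ∈ valueSpan A := by
  refine Submodule.mem_sup_right (Submodule.subset_span ?_)
  rcases lt_or_gt_of_ne (show s ≠ t by omega) with hst | hst
  · exact ⟨(s, t), by simp; omega, rfl⟩
  · exact ⟨(t, s), by simp; omega, mul_comm _ _⟩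

theorem exists_sum_of_mem_span_image {ι : Type*} {v : ι → ℝ} {s : Finset ι} {x : ℝ}
    (hx : x ∈ Submodule.span ℚ (v '' s)) : ∃ c : ι → ℚ, ∑ i ∈ s, c i • v i = x := by
  classical
  obtain ⟨c, rfl⟩ := (Submodule.mem_span_image_finset_iff_exists_fun ℚ).1 hx
  refine ⟨fun i => if h : i ∈ s then c ⟨i, h⟩ else 0, ?_⟩
  rw [← Finset.sum_coe_sort]
  exact Finset.sum_congr rfl fun i _ => by
    dsimp only
    rw [dif_pos i.2]

theorem mem_valueSpan {x : ℝ} (hx : x ∈ valueSpan A) :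
    ∃ (c₀ : ℚ) (c c' : ℕ → ℚ) (d : ℕ × ℕ → ℚ),
      x = c₀ + (∑ s ∈ Finset.Icc 2 A, (c s : ℝ) * zv s) +
          (∑ s ∈ (Finset.Icc (A + 1) (2 * A - 1)).filter (fun s => s % 2 = 1),
            (c' s : ℝ) * zv s) +
          ∑ q ∈ (Finset.Icc 2 A ×ˢ Finset.Icc 2 A).filter
              (fun q => q.1 < q.2 ∧ (q.1 + q.2) % 2 = 1),
            (d q : ℝ) * (zv q.1 * zv q.2) := by
  obtain ⟨y₁, hy₁, w, hw, rfl⟩ := Submodule.mem_sup.1 hx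
  obtain ⟨y₂, hy₂, v, hv, rfl⟩ := Submodule.mem_sup.1 hy₁
  obtain ⟨y₃, hy, u, hu, rfl⟩ := Submodule.mem_sup.1 hy₂
  obtain ⟨c₀, rfl⟩ := Submodule.mem_span_singleton.1 hy
  obtain ⟨c, rfl⟩ := exists_sum_of_mem_span_image hu
  obtain ⟨c', rfl⟩ := exists_sum_of_mem_span_image hv
  obtain ⟨d, rfl⟩ := exists_sum_of_mem_span_image hw
  exact ⟨c₀, c, c', d, by simp only [Rat.smul_def, mul_one]⟩

theorem zetaSpan_two_mul_le_valueSpan : zetaSpan (2 * A) 1 ≤ valueSpan A := by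
  refine Submodule.span_le.2 (Set.insert_subset one_mem_valueSpan ?_)
  rintro _ ⟨s, ⟨h2, hA, hs⟩, rfl⟩
  rcases le_or_gt s A with h | h
  · exact zv_mem_valueSpan h2 h
  · exact zv_mem_valueSpan_of_odd h hA hs

theorem mul_mem_valueSpan {ε δ : ℕ} (h : (ε + δ) % 2 = 1) {x y : ℝ} (hx : x ∈ zetaSpan A ε)
    (hy : y ∈ zetaSpan A δ) : x * y ∈ valueSpan A := by
  have hle : zetaSpan A ε * zetaSpan A δ ≤ valueSpan A := by
    rw [zetaSpan, zetaSpan, Submodule.span_mul_span, Submodule.span_le]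
    rintro _ ⟨_, rfl | ⟨s, ⟨hs2, hsA, hs⟩, rfl⟩, _, rfl | ⟨t, ⟨ht2, htA, ht⟩, rfl⟩, rfl⟩
    · simpa using one_mem_valueSpan
    · simpa using zv_mem_valueSpan ht2 htA
    · simpa using zv_mem_valueSpan hs2 hsA
    · exact zv_mul_zv_mem_valueSpan hs2 hsA ht2 htA (by omega)
  exact hle (Submodule.mul_mem_mul hx hy)

end valueSpan

/-- The sum of a symmetric function over `{(x, y) | x ≥ y + r}`. -/
theorem tsum_triangle_of_symm {G : ℕ → ℕ → ℝ} (hG : Summable fun q : ℕ × ℕ => G q.1 q.2)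
    (hsym : ∀ x y, G x y = G y x) (r : ℕ) :
    ∑' q : ℕ × ℕ, G (q.2 + (q.1 + r)) q.2 =
      ((∑' q : ℕ × ℕ, G q.1 q.2) + ∑' y, G y y) / 2 -
        ∑ m ∈ Finset.range r, ∑' y, G (y + m) y := by
  have hi : ∀ r : ℕ, Function.Injective fun q : ℕ × ℕ => (q.2 + (q.1 + r), q.2) := by
    rintro r ⟨m, y⟩ ⟨m', y'⟩ h
    simp only [Prod.mk.injEq] at h ⊢
    omega
  have hi' : Function.Injective fun q : ℕ × ℕ => (q.2, q.2 + (q.1 + 1)) := by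
    rintro ⟨m, y⟩ ⟨m', y'⟩ h
    simp only [Prod.mk.injEq] at h ⊢
    omega
  have hs : ∀ r : ℕ, Summable fun q : ℕ × ℕ => G (q.2 + (q.1 + r)) q.2 := fun r =>
    hG.comp_injective (hi r)
  have hD : ∀ r : ℕ, ∑' q : ℕ × ℕ, G (q.2 + (q.1 + r)) q.2 = ∑' m, ∑' y, G (y + (m + r)) y :=
    fun r => (hs r).tsum_prod
  have hsD : Summable fun m => ∑' y, G (y + m) y := (hs 0).prod
  have hcompl : IsCompl (Set.range fun q : ℕ × ℕ => (q.2 + (q.1 + 0), q.2))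
      (Set.range fun q : ℕ × ℕ => (q.2, q.2 + (q.1 + 1))) := by
    rw [isCompl_iff, Set.disjoint_iff, codisjoint_iff_le_sup]
    constructor
    · rintro _ ⟨⟨⟨m, y⟩, rfl⟩, ⟨m', y'⟩, h⟩
      simp only [Prod.mk.injEq] at h
      omega
    · rintro ⟨x, y⟩ -
      rcases le_or_gt y x with h | h
      · exact Or.inl ⟨(x - y, y), by simp; omega⟩
      · exact Or.inr ⟨(y - x - 1, x), by simp; omega⟩
  have h1 : HasSum (fun q : ℕ × ℕ => G q.1 q.2)
      ((∑' q : ℕ × ℕ, G (q.2 + (q.1 + 0)) q.2) + ∑' q : ℕ × ℕ, G (q.2 + (q.1 + 1)) q.2) := by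
    have ha := (hi 0).hasSum_range_iff (f := fun q : ℕ × ℕ => G q.1 q.2)
      (a := ∑' q : ℕ × ℕ, G (q.2 + (q.1 + 0)) q.2)
    have hb := hi'.hasSum_range_iff (f := fun q : ℕ × ℕ => G q.1 q.2)
      (a := ∑' q : ℕ × ℕ, G (q.2 + (q.1 + 1)) q.2)
    exact HasSum.add_isCompl hcompl (ha.2 (hs 0).hasSum)
      (hb.2 ((hasSum_congr fun q => hsym _ _).1 (hs 1).hasSum))
  rw [h1.tsum_eq, hD, hD, hD]
  have h2 := hsD.tsum_eq_zero_add
  have h3 := hsD.sum_add_tsum_nat_add r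
  simp only [add_zero] at h2 ⊢
  linarith

/-- The summand of `statement14`, in the variables `a = k₁ + r` and `b = k₂`. -/
noncomputable def wellPoised (A n e f : ℕ) (a b : ℝ) : ℝ :=
  ((a + b + n) ^ e * (a - b) ^ f) /
    ((ascPochhammer ℝ (n + 1)).eval a ^ A * (ascPochhammer ℝ (n + 1)).eval b ^ A)

section wellPoised

variable {A n e f : ℕ}

theorem wellPoised_comm (hf : f % 2 = 0) (a b : ℝ) :
    wellPoised A n e f a b = wellPoised A n e f b a := by
  rw [wellPoised, wellPoised, ← neg_sub b a, (Nat.even_iff.2 hf).neg_pow, add_comm a b,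
    mul_comm (_ ^ A)]

/-- The factors into which the summand of `statement14` separates. -/
noncomputable def centeredTerm (A n k : ℕ) (x : ℝ) : ℝ :=
  (x + n / 2) ^ k / (ascPochhammer ℝ (n + 1)).eval x ^ A

theorem centeredTerm_eq (k : ℕ) (x : ℝ) : centeredTerm A n k x =
    aeval x ((X + C ((n : ℚ) / 2)) ^ k) / (ascPochhammer ℝ (n + 1)).eval x ^ A := by
  simp [centeredTerm]

theorem summable_centeredTerm {k : ℕ} (hk : k + 2 ≤ A * (n + 1)) :
    Summable fun b : ℕ => centeredTerm A n k ((b : ℝ) + 1) := by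
  simp only [centeredTerm_eq]
  exact summable_aeval_div _ n A (by rwa [natDegree_pow, natDegree_X_add_C, mul_one])

theorem tsum_centeredTerm_mem {k : ℕ} (hk : k + 2 ≤ A * (n + 1)) :
    ∑' b : ℕ, centeredTerm A n k ((b : ℝ) + 1) ∈ zetaSpan A (k + A * (n + 1)) := by
  simp only [centeredTerm_eq]
  refine tsum_mem_zetaSpan _ n A _ (by rwa [natDegree_pow, natDegree_X_add_C, mul_one]) fun x => ?_
  rw [add_assoc, ← two_mul, pow_add, (even_two_mul _).neg_one_pow, mul_one, map_pow, map_pow,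
    ← mul_pow]
  congr 1
  simp
  ring

theorem wellPoised_eq_sum (a b : ℝ) : wellPoised A n e f a b =
    ∑ i ∈ Finset.range (e + 1), ∑ j ∈ Finset.range (f + 1),
      (((-1) ^ (f - j) * e.choose i * f.choose j : ℚ) : ℝ) *
        (centeredTerm A n (i + j) a * centeredTerm A n ((e - i) + (f - j)) b) := by
  have h1 := add_pow (a + (n : ℝ) / 2) (b + n / 2) e
  have h2 := add_pow (a + (n : ℝ) / 2) (-(b + n / 2)) f
  rw [wellPoised, show a + b + n = a + (n : ℝ) / 2 + (b + n / 2) by ring,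
    show a - b = a + (n : ℝ) / 2 + -(b + n / 2) by ring, h1, h2, Finset.sum_mul_sum,
    Finset.sum_div]
  refine Finset.sum_congr rfl fun i _ => ?_
  rw [Finset.sum_div]
  refine Finset.sum_congr rfl fun j _ => ?_
  rw [centeredTerm, centeredTerm, div_mul_div_comm, ← mul_div_assoc, neg_pow]
  push_cast
  congr 1
  ring

theorem hasSum_mul_prod {u v : ℕ → ℝ} (hu : Summable u) (hv : Summable v) :
    HasSum (fun q : ℕ × ℕ => u q.1 * v q.2) ((∑' b, u b) * ∑' b, v b) :=
  hu.hasSum.mul hv.hasSum (summable_mul_of_summable_norm hu.norm hv.norm)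

theorem hasSum_wellPoised (hef : e + f + 2 ≤ A * (n + 1)) :
    HasSum (fun q : ℕ × ℕ => wellPoised A n e f (q.1 + 1) (q.2 + 1))
      (∑ i ∈ Finset.range (e + 1), ∑ j ∈ Finset.range (f + 1),
        (((-1) ^ (f - j) * e.choose i * f.choose j : ℚ) : ℝ) *
          ((∑' b : ℕ, centeredTerm A n (i + j) ((b : ℝ) + 1)) *
            ∑' b : ℕ, centeredTerm A n ((e - i) + (f - j)) ((b : ℝ) + 1))) := by
  have hprod : ∀ i ∈ Finset.range (e + 1), ∀ j ∈ Finset.range (f + 1),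
      HasSum (fun q : ℕ × ℕ => centeredTerm A n (i + j) ((q.1 : ℝ) + 1) *
        centeredTerm A n ((e - i) + (f - j)) ((q.2 : ℝ) + 1))
        ((∑' b : ℕ, centeredTerm A n (i + j) ((b : ℝ) + 1)) *
          ∑' b : ℕ, centeredTerm A n ((e - i) + (f - j)) ((b : ℝ) + 1)) := by
    intro i hi j hj
    rw [Finset.mem_range] at hi hj
    exact hasSum_mul_prod (summable_centeredTerm (by omega)) (summable_centeredTerm (by omega))
  refine (hasSum_congr fun q => wellPoised_eq_sum _ _).2 ?_
  exact hasSum_sum fun i hi => hasSum_sum fun j hj => (hprod i hi j hj).mul_left _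

theorem tsum_wellPoised_mem (hef : e + f + 2 ≤ A * (n + 1)) (he : e % 2 = 1) (hf : f % 2 = 0) :
    ∑' q : ℕ × ℕ, wellPoised A n e f (q.1 + 1) (q.2 + 1) ∈ valueSpan A := by
  rw [(hasSum_wellPoised hef).tsum_eq]
  refine sum_mem fun i hi => sum_mem fun j hj => ?_
  rw [Finset.mem_range] at hi hj
  rw [← Rat.smul_def]
  exact Submodule.smul_mem _ _ (mul_mem_valueSpan (by omega)
    (tsum_centeredTerm_mem (by omega)) (tsum_centeredTerm_mem (by omega)))

theorem ascPochhammer_eval_mul_sq (n j : ℕ) (x : ℝ) :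
    (ascPochhammer ℝ (n + j + 1)).eval x ^ 2 =
      ((ascPochhammer ℝ (n + 1)).eval (x + j) * (ascPochhammer ℝ (n + 1)).eval x) *
        ((ascPochhammer ℝ j).eval (x + (n + 1)) * (ascPochhammer ℝ j).eval x) := by
  have h1 := congrArg (eval x) (ascPochhammer_mul ℝ (n + 1) j)
  have h2 := congrArg (eval x) (ascPochhammer_mul ℝ j (n + 1))
  rw [show n + 1 + j = n + j + 1 by ring] at h1
  rw [show j + (n + 1) = n + j + 1 by ring] at h2
  simp only [eval_mul, eval_comp, eval_add, eval_X, eval_natCast, eval_one, Nat.cast_add, Nat.cast_one]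
    at h1 h2
  rw [sq]
  nth_rewrite 1 [← h1]
  rw [← h2]
  ring

theorem tsum_wellPoised_diagonal_mem (hef : e + f + 2 ≤ A * (n + 1)) (he : e % 2 = 1) (j : ℕ) :
    ∑' b : ℕ, wellPoised A n e f (b + 1 + j) (b + 1) ∈ zetaSpan (2 * A) 1 := by
  set N : ℚ[X] := (C 2 * X + C ((n : ℚ) + j)) ^ e * C ((j : ℚ) ^ f) *
    ((ascPochhammer ℚ j).comp (X + C ((n : ℚ) + 1)) * ascPochhammer ℚ j) ^ A with hN
  have hev : ∀ x : ℝ, aeval x N = (2 * x + (n + j)) ^ e * (j : ℝ) ^ f *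
      ((ascPochhammer ℝ j).eval (x + (n + 1)) * (ascPochhammer ℝ j).eval x) ^ A := by
    intro x
    simp [hN, aeval_comp, aeval_ascPochhammer_rat]
  have hterm : ∀ b : ℕ, wellPoised A n e f (b + 1 + j) (b + 1) =
      aeval ((b : ℝ) + 1) N / (ascPochhammer ℝ (n + j + 1)).eval ((b : ℝ) + 1) ^ (2 * A) := by
    intro b
    have h1 := ascPochhammer_pos j ((b : ℝ) + 1) (by positivity)
    have h2 := ascPochhammer_pos j ((b : ℝ) + 1 + (n + 1)) (by positivity)
    rw [hev, pow_mul, ascPochhammer_eval_mul_sq, mul_pow (_ * _) (_ * _) A,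
      mul_div_mul_right _ _ (by positivity), wellPoised, mul_pow (eval _ _)]
    congr 3 <;> ring
  simp only [hterm]
  refine tsum_mem_zetaSpan N (n + j) (2 * A) 1 ?_ fun x => ?_
  · have h1 : (C (2 : ℚ) * X + C ((n : ℚ) + j)).natDegree ≤ 1 := natDegree_linear_le
    have h2 : N.natDegree ≤ e * 1 + 0 + A * (j * 1 + j) := by
      refine natDegree_mul_le_of_le (natDegree_mul_le_of_le (natDegree_pow_le_of_le _ h1)
        (natDegree_C _).le) (natDegree_pow_le_of_le _ (natDegree_mul_le_of_le ?_ ?_))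
      · rw [natDegree_comp, ascPochhammer_natDegree, natDegree_X_add_C]
      · rw [ascPochhammer_natDegree]
    nlinarith
  · have h1 := ascPochhammer_eval_one_sub_sub j (x + (n + 1))
    have h2 := ascPochhammer_eval_one_sub_sub j x
    rw [show (1 : ℝ) - j - (x + (n + 1)) = -(n + j : ℕ) - x by push_cast; ring] at h1
    rw [show (1 : ℝ) - j - x = -(n + j : ℕ) - x + (n + 1) by push_cast; ring] at h2
    have h3 : ((-1 : ℝ) ^ j) * (-1) ^ j = 1 := by rw [← pow_add, Even.neg_one_pow ⟨j, rfl⟩]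
    rw [hev, hev, h1, h2, show (2 * (-(n + j : ℕ) - x) + (n + j) : ℝ) = -(2 * x + (n + j)) by
      push_cast; ring, (Nat.odd_iff.2 he).neg_pow, mul_mul_mul_comm, h3, pow_add, mul_assoc 2,
      (even_two_mul _).neg_one_pow]
    ring

end wellPoised

/-- The index set of `statement14`, parametrised by `(k₁ - k₂, k₂ - 1)`. -/
def triangleEquiv : ℕ × ℕ ≃ {q : ℕ × ℕ // q.2 ≤ q.1 ∧ 1 ≤ q.2} where
  toFun q := ⟨(q.2 + 1 + q.1, q.2 + 1), by simp⟩
  invFun k := (k.1.1 - k.1.2, k.1.2 - 1)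
  left_inv q := by simp
  right_inv := by
    rintro ⟨⟨a, b⟩, h1, h2⟩
    simp only [Subtype.mk.injEq, Prod.mk.injEq] at h1 h2 ⊢
    omega

theorem statement14 (A n r e f : ℕ) (hA : 2 ≤ A) (hef : e + f + 2 ≤ A * (n + 1))
    (he : e % 2 = 1) (hf : f % 2 = 0) (hr : n + 1 ≤ r) :
    Summable (fun k : {q : ℕ × ℕ // q.2 ≤ q.1 ∧ 1 ≤ q.2} =>
        (((k.1.1 : ℝ) + k.1.2 + n + r) ^ e * ((k.1.1 : ℝ) - k.1.2 + r) ^ f) /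
          (((ascPochhammer ℝ (n + 1)).eval ((k.1.1 : ℝ) + r)) ^ A *
            ((ascPochhammer ℝ (n + 1)).eval (k.1.2 : ℝ)) ^ A)) ∧
    ∃ (c₀ : ℚ) (c c' : ℕ → ℚ) (d : ℕ × ℕ → ℚ),
      (∑' k : {q : ℕ × ℕ // q.2 ≤ q.1 ∧ 1 ≤ q.2},
          (((k.1.1 : ℝ) + k.1.2 + n + r) ^ e * ((k.1.1 : ℝ) - k.1.2 + r) ^ f) /
            (((ascPochhammer ℝ (n + 1)).eval ((k.1.1 : ℝ) + r)) ^ A *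
              ((ascPochhammer ℝ (n + 1)).eval (k.1.2 : ℝ)) ^ A))
        = c₀ + (∑ s ∈ Finset.Icc 2 A, (c s : ℝ) * zv s) +
          (∑ s ∈ (Finset.Icc (A + 1) (2 * A - 1)).filter (fun s => s % 2 = 1),
            (c' s : ℝ) * zv s) +
          ∑ q ∈ (Finset.Icc 2 A ×ˢ Finset.Icc 2 A).filter
              (fun q => q.1 < q.2 ∧ (q.1 + q.2) % 2 = 1),
            (d q : ℝ) * (zv q.1 * zv q.2) := by
  set G : ℕ → ℕ → ℝ := fun x y => wellPoised A n e f (x + 1) (y + 1) with hG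
  have hterm : ∀ q : ℕ × ℕ, ((((triangleEquiv q).1.1 : ℝ) + (triangleEquiv q).1.2 + n + r) ^ e *
      (((triangleEquiv q).1.1 : ℝ) - (triangleEquiv q).1.2 + r) ^ f) /
        (((ascPochhammer ℝ (n + 1)).eval (((triangleEquiv q).1.1 : ℝ) + r)) ^ A *
          ((ascPochhammer ℝ (n + 1)).eval ((triangleEquiv q).1.2 : ℝ)) ^ A) =
      G (q.2 + (q.1 + r)) q.2 := by
    intro q
    have hk : ∀ a b : ℝ, (a + b + n + r) ^ e * (a - b + r) ^ f /
        ((ascPochhammer ℝ (n + 1)).eval (a + r) ^ A * (ascPochhammer ℝ (n + 1)).eval b ^ A) =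
        wellPoised A n e f (a + r) b := by
      intro a b
      rw [wellPoised, show a + r + b + n = a + b + n + r by ring,
        show a + r - b = a - b + r by ring]
    rw [hk]
    simp only [triangleEquiv, Equiv.coe_fn_mk, hG]
    push_cast
    congr 1
    ring
  have hS : Summable fun q : ℕ × ℕ => G q.1 q.2 := (hasSum_wellPoised hef).summable
  have hsym : ∀ x y, G x y = G y x := fun x y => wellPoised_comm hf _ _
  have hD : ∀ m : ℕ, ∑' y, G (y + m) y ∈ valueSpan A := by
    intro m
    have h := zetaSpan_two_mul_le_valueSpan (tsum_wellPoised_diagonal_mem hef he m)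
    simpa only [hG, Nat.cast_add, add_right_comm] using h
  constructor
  · rw [← triangleEquiv.summable_iff]
    refine (hS.comp_injective (i := fun q : ℕ × ℕ => (q.2 + (q.1 + r), q.2)) ?_).congr
      fun q => (hterm q).symm
    rintro ⟨m, y⟩ ⟨m', y'⟩ h
    simp only [Prod.mk.injEq] at h ⊢
    omega
  · rw [← triangleEquiv.tsum_eq, tsum_congr hterm, tsum_triangle_of_symm hS hsym]
    refine mem_valueSpan (sub_mem ?_ (sum_mem fun m _ => hD m))
    have h := Submodule.smul_mem (valueSpan A) (1 / 2 : ℚ)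
      (add_mem (tsum_wellPoised_mem hef he hf) (hD 0))
    rw [Rat.smul_def] at h
    simp only [add_zero, hG] at h ⊢
    convert h using 1
    push_cast
    ring
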